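/- arXiv:2305.11630 — 6 statements merged into one kernel-verified Lean document; each statement's English description precedes it below -/
import Mathlib

section
/- Let R₁ and R₂ be 4×4 real orthogonal matrices all of whose entries have absolute value 1/2 (balanced four-splitter matrices). Then there exist a permutation σ of the four row indices, a sign vector ε : {1,2,3,4} → {−1,+1}, and a sign δ ∈ {−1,+1} such that R₂ = Dε · Pσ · R₁ · C, where Dε is the diagonal matrix with diagonal entries ε, Pσ is the permutation matrix of σ, and C = diag(1,1,1,δ). In other words, any balanced four-splitter matrix can be transformed into any other by a sequence of row permutations, row negations, and negation of the last column. -/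
open Matrix

/-- The permutation matrix of `σ`: entry `(i, j)` is `1` if `σ i = j`, else `0`. -/
def permMat (σ : Equiv.Perm (Fin 4)) : Matrix (Fin 4) (Fin 4) ℝ :=
  fun i j => if σ i = j then 1 else 0

section BalancedFourSplitter

variable {R : Matrix (Fin 4) (Fin 4) ℝ}

/-- The entries of a balanced matrix are `1 / 2` or `-1 / 2`. -/
theorem entry_eq_or_of_balanced (hb : ∀ i j, |R i j| = 1 / 2) (i j : Fin 4) :
    R i j = 1 / 2 ∨ R i j = -(1 / 2) :=
  (abs_eq (by norm_num)).1 (hb i j)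

/-- Distinct rows of a real orthogonal `4 × 4` matrix are orthogonal. -/
theorem row_orthogonal (ho : Rᵀ * R = 1) {i j : Fin 4} (hij : i ≠ j) :
    R i 0 * R j 0 + R i 1 * R j 1 + R i 2 * R j 2 + R i 3 * R j 3 = 0 := by
  have ho' : R * Rᵀ = 1 := _root_.mul_eq_one_comm.1 ho
  have h := congrFun (congrFun ho' i) j
  simpa [Matrix.mul_apply, Fin.sum_univ_four, Matrix.one_apply_ne hij] using h

/-- The product of the entries of a row of a balanced four-splitter matrix
is the same for all rows. -/
theorem row_prod_eq (ho : Rᵀ * R = 1) (hb : ∀ i j, |R i j| = 1 / 2) (i j : Fin 4) :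
    R i 0 * R i 1 * R i 2 * R i 3 = R j 0 * R j 1 * R j 2 * R j 3 := by
  rcases eq_or_ne i j with rfl | hij
  · rfl
  have key (k : Fin 4) : R i k = R j k ∨ R i k = -R j k :=
    abs_eq_abs.1 ((hb i k).trans (hb j k).symm)
  have sq (k : Fin 4) : R j k * R j k = 1 / 4 := by
    rw [← abs_mul_abs_self, hb]; norm_num
  have h := row_orthogonal ho hij
  have h0 := sq 0
  have h1 := sq 1
  have h2 := sq 2
  have h3 := sq 3
  rcases key 0 with e0 | e0 <;> rcases key 1 with e1 | e1 <;>
    rcases key 2 with e2 | e2 <;> rcases key 3 with e3 | e3 <;>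
    rw [e0, e1, e2, e3] at h ⊢ <;> first | (exfalso; linarith) | ring

/-- The relative signs of the second and third entries of each row with respect to the first. -/
noncomputable def rowSigns (R : Matrix (Fin 4) (Fin 4) ℝ) (i : Fin 4) : Prop × Prop :=
  (R i 0 = R i 1, R i 0 = R i 2)

/-- A row of a balanced four-splitter matrix is determined by its relative signs. -/
theorem rowSigns_bijective (ho : Rᵀ * R = 1) (hb : ∀ i j, |R i j| = 1 / 2) :
    Function.Bijective (rowSigns R) := by
  rw [Fintype.bijective_iff_injective_and_card]
  refine ⟨fun i j hij => ?_, by simp⟩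
  by_contra hne
  simp only [rowSigns, Prod.mk.injEq, eq_iff_iff] at hij
  obtain ⟨ha, hc⟩ := hij
  have h := row_orthogonal ho hne
  have key := entry_eq_or_of_balanced hb
  have h3 : R i 3 * R j 3 = 1 / 4 ∨ R i 3 * R j 3 = -(1 / 4) := by
    rcases key i 3 with e | e <;> rcases key j 3 with f | f <;> rw [e, f] <;> norm_num
  rcases key i 0 with a0 | a0 <;> rcases key i 1 with a1 | a1 <;>
    rcases key i 2 with a2 | a2 <;> rcases key j 0 with b0 | b0 <;>
    rcases key j 1 with b1 | b1 <;> rcases key j 2 with b2 | b2 <;>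
    rw [a0, a1, b0, b1] at ha <;> rw [a0, a2, b0, b2] at hc <;>
    rw [a0, a1, a2, b0, b1, b2] at h <;>
    rcases h3 with h3 | h3 <;> rw [h3] at h <;> revert ha hc h <;> norm_num

end BalancedFourSplitter

/-- Any balanced four-splitter matrix can be transformed into any other by row
permutations, row negations, and a negation of the last column. -/
theorem balanced_four_splitter_equiv
    (R₁ R₂ : Matrix (Fin 4) (Fin 4) ℝ)
    (h₁o : R₁ᵀ * R₁ = 1) (h₂o : R₂ᵀ * R₂ = 1)
    (h₁b : ∀ i j, |R₁ i j| = 1 / 2) (h₂b : ∀ i j, |R₂ i j| = 1 / 2) :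
    ∃ (σ : Equiv.Perm (Fin 4)) (ε : Fin 4 → ℝ) (δ : ℝ),
      (∀ i, ε i = 1 ∨ ε i = -1) ∧ (δ = 1 ∨ δ = -1) ∧
      R₂ = Matrix.diagonal ε * permMat σ * R₁ *
        Matrix.diagonal (fun i => if i = 3 then δ else 1) := by
  have key₁ := entry_eq_or_of_balanced h₁b
  have key₂ := entry_eq_or_of_balanced h₂b
  have sq₁ (i k : Fin 4) : R₁ i k ^ 2 = 1 / 4 := by rw [← sq_abs, h₁b]; norm_num
  have sq₂ (i k : Fin 4) : R₂ i k ^ 2 = 1 / 4 := by rw [← sq_abs, h₂b]; norm_num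
  let e₁ := Equiv.ofBijective _ (rowSigns_bijective h₁o h₁b)
  let e₂ := Equiv.ofBijective _ (rowSigns_bijective h₂o h₂b)
  let σ : Equiv.Perm (Fin 4) := e₂.trans e₁.symm
  have hσ (i : Fin 4) : rowSigns R₁ (σ i) = rowSigns R₂ i := e₁.apply_symm_apply (e₂ i)
  have rel (i k : Fin 4) (h : R₁ (σ i) 0 = R₁ (σ i) k ↔ R₂ i 0 = R₂ i k) :
      R₁ (σ i) 0 * R₁ (σ i) k = R₂ i 0 * R₂ i k := by
    rcases key₁ (σ i) 0 with a | a <;> rcases key₁ (σ i) k with b | b <;>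
      rcases key₂ i 0 with c | c <;> rcases key₂ i k with d | d <;>
      rw [a, b, c, d] at h ⊢ <;> revert h <;> norm_num
  have rel₁ (i : Fin 4) : R₁ (σ i) 0 * R₁ (σ i) 1 = R₂ i 0 * R₂ i 1 :=
    rel i 1 (iff_of_eq (congrArg Prod.fst (hσ i)))
  have rel₂ (i : Fin 4) : R₁ (σ i) 0 * R₁ (σ i) 2 = R₂ i 0 * R₂ i 2 :=
    rel i 2 (iff_of_eq (congrArg Prod.snd (hσ i)))
  refine ⟨σ, fun i => 4 * (R₂ i 0 * R₁ (σ i) 0),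
    256 * ((R₁ 0 0 * R₁ 0 1 * R₁ 0 2 * R₁ 0 3) * (R₂ 0 0 * R₂ 0 1 * R₂ 0 2 * R₂ 0 3)),
    fun i => ?_, ?_, ?_⟩
  · rw [← sq_eq_sq_iff_eq_or_eq_neg, mul_pow, mul_pow, sq₁, sq₂]
    norm_num
  · rw [← sq_eq_sq_iff_eq_or_eq_neg]
    simp only [mul_pow, sq₁, sq₂]
    norm_num
  · ext i k
    rw [Matrix.mul_diagonal, Matrix.mul_assoc, Matrix.diagonal_mul]
    have hperm : (permMat σ * R₁) i k = R₁ (σ i) k := by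
      simp [permMat, Matrix.mul_apply]
    rw [hperm, row_prod_eq h₁o h₁b 0 (σ i), row_prod_eq h₂o h₂b 0 i]
    have h0 := sq₁ (σ i) 0
    have h3 := sq₁ (σ i) 3
    have g0 := sq₂ i 0
    have g1 := sq₂ i 1
    have g2 := sq₂ i 2
    have r1 := rel₁ i
    have r2 := rel₂ i
    generalize σ i = j at *
    fin_cases k
    · simp
      linear_combination (-4 * R₂ i 0) * h0
    · simp
      linear_combination (-4 * R₂ i 0) * r1 - 4 * R₂ i 1 * g0
    · simp
      linear_combination (-4 * R₂ i 0) * r2 - 4 * R₂ i 2 * g0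
    · simp
      have hx : R₁ j 1 * R₁ j 2 = R₂ i 1 * R₂ i 2 := by
        linear_combination (-4 * R₁ j 1 * R₁ j 2) * h0 + 4 * R₂ i 1 * R₂ i 2 * g0 +
          4 * R₁ j 0 * R₁ j 2 * r1 + 4 * R₂ i 0 * R₂ i 1 * r2
      calc R₂ i 3 = 1024 * R₂ i 0 ^ 2 * R₁ j 0 ^ 2 * R₁ j 3 ^ 2 *
              (R₂ i 1 * R₂ i 2) * (R₂ i 1 * R₂ i 2) * R₂ i 3 := by
            rw [g0, h0, h3]
            linear_combination (-4 * R₂ i 3) * g1 - 16 * R₂ i 1 ^ 2 * R₂ i 3 * g2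
        _ = _ := by rw [← hx]; linear_combination (1024 * R₂ i 0 ^ 2 * R₁ j 0 ^ 2 * R₁ j 3 ^ 2 *
              (R₁ j 1 * R₁ j 2) * R₂ i 3) * hx
end

section
/- The set of 4×4 real matrices H all of whose entries lie in {−1, +1} and which satisfy H·Hᵀ = 4·I (that is, the set of order-4 real Hadamard matrices) has exactly 768 elements. -/
open Matrix

/-- The real sign encoded by a Boolean. -/
noncomputable def boolSign (b : Bool) : ℝ := if b then 1 else -1

/-- The sign matrix with four given rows. -/
noncomputable def signMatrix
    (p : (Fin 4 → Bool) × (Fin 4 → Bool) × (Fin 4 → Bool) × (Fin 4 → Bool)) :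
    Matrix (Fin 4) (Fin 4) ℝ :=
  Matrix.of fun i j => boolSign (![p.1, p.2.1, p.2.2.1, p.2.2.2] i j)

/-- Two Boolean rows agree in exactly as many places as they differ. -/
def RowsBalanced (a b : Fin 4 → Bool) : Prop :=
  ∑ j, (if a j = b j then 1 else -1 : ℤ) = 0

instance (a b : Fin 4 → Bool) : Decidable (RowsBalanced a b) :=
  inferInstanceAs (Decidable (_ = _))

theorem boolSign_injective : Function.Injective boolSign := by
  intro a b h
  cases a <;> cases b <;> simp [boolSign] at h ⊢ <;> norm_num at h

theorem boolSign_mul (a b : Bool) :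
    boolSign a * boolSign b = ((if a = b then 1 else -1 : ℤ) : ℝ) := by
  cases a <;> cases b <;> simp [boolSign]

theorem sum_boolSign_mul_eq_zero_iff (a b : Fin 4 → Bool) :
    ∑ j, boolSign (a j) * boolSign (b j) = 0 ↔ RowsBalanced a b := by
  simp only [boolSign_mul, RowsBalanced]
  exact_mod_cast Iff.rfl

theorem sum_boolSign_mul_self (a : Fin 4 → Bool) :
    ∑ j, boolSign (a j) * boolSign (a j) = 4 := by
  simp [boolSign_mul]

theorem RowsBalanced.comm {a b : Fin 4 → Bool} : RowsBalanced a b ↔ RowsBalanced b a := by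
  simp only [RowsBalanced, eq_comm]

theorem signMatrix_injective : Function.Injective signMatrix := by
  rintro ⟨a, b, c, d⟩ ⟨a', b', c', d'⟩ h
  have key (i j : Fin 4) : ![a, b, c, d] i j = ![a', b', c', d'] i j :=
    boolSign_injective (congrFun (congrFun h i) j)
  simp only [Prod.mk.injEq]
  exact ⟨funext (key 0), funext (key 1), funext (key 2), funext (key 3)⟩

theorem signMatrix_mul_transpose_iff (a b c d : Fin 4 → Bool) :
    signMatrix (a, b, c, d) * (signMatrix (a, b, c, d))ᵀ = (4 : ℝ) • 1 ↔
      RowsBalanced a b ∧ (RowsBalanced a c ∧ RowsBalanced b c) ∧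
        RowsBalanced a d ∧ RowsBalanced b d ∧ RowsBalanced c d := by
  have entry (i k : Fin 4) : (signMatrix (a, b, c, d) * (signMatrix (a, b, c, d))ᵀ) i k =
      ∑ j, boolSign (![a, b, c, d] i j) * boolSign (![a, b, c, d] k j) := rfl
  simp only [← Matrix.ext_iff, entry]
  constructor
  · intro h
    have off (i k : Fin 4) (hik : i ≠ k) : RowsBalanced (![a, b, c, d] i) (![a, b, c, d] k) := by
      rw [← sum_boolSign_mul_eq_zero_iff, h i k]
      simp [hik]
    exact ⟨off 0 1 (by decide), ⟨off 0 2 (by decide), off 1 2 (by decide)⟩,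
      off 0 3 (by decide), off 1 3 (by decide), off 2 3 (by decide)⟩
  · rintro ⟨hab, ⟨hac, hbc⟩, had, hbd, hcd⟩ i k
    by_cases hik : i = k
    · subst hik
      simp [sum_boolSign_mul_self]
    · rw [(sum_boolSign_mul_eq_zero_iff _ _).2]
      · simp [hik]
      · fin_cases i <;> fin_cases k <;> first
          | exact absurd rfl hik
          | assumption
          | (rw [RowsBalanced.comm]; assumption)

theorem exists_signMatrix_eq {H : Matrix (Fin 4) (Fin 4) ℝ}
    (hH : ∀ i j, H i j = 1 ∨ H i j = -1) : ∃ p, signMatrix p = H := by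
  classical
  refine ⟨(fun j => decide (H 0 j = 1), fun j => decide (H 1 j = 1),
    fun j => decide (H 2 j = 1), fun j => decide (H 3 j = 1)), ?_⟩
  have sign_decide (i j : Fin 4) : boolSign (decide (H i j = 1)) = H i j := by
    rcases hH i j with h | h <;> norm_num [boolSign, h]
  ext i j
  fin_cases i <;> exact sign_decide _ j

theorem sum_balanced_quadruples :
    ∑ a : Fin 4 → Bool, ∑ b : Fin 4 → Bool, (if RowsBalanced a b then
      ∑ c : Fin 4 → Bool, (if RowsBalanced a c ∧ RowsBalanced b c then
        ∑ d : Fin 4 → Bool, (if RowsBalanced a d ∧ RowsBalanced b d ∧ RowsBalanced c d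
          then 1 else 0)
        else 0) else 0) = 768 := by
  decide +kernel

/-- There are exactly 768 order-4 real Hadamard matrices: 4×4 matrices with all
entries in {−1, +1} whose rows are pairwise orthogonal, i.e. `H * Hᵀ = 4 • 1`. -/
theorem card_hadamard_order_four :
    {H : Matrix (Fin 4) (Fin 4) ℝ |
      (∀ i j, H i j = 1 ∨ H i j = -1) ∧ H * Hᵀ = (4 : ℝ) • 1}.ncard = 768 := by
  let S : Finset ((Fin 4 → Bool) × (Fin 4 → Bool) × (Fin 4 → Bool) × (Fin 4 → Bool)) :=
    {p | RowsBalanced p.1 p.2.1 ∧ (RowsBalanced p.1 p.2.2.1 ∧ RowsBalanced p.2.1 p.2.2.1) ∧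
      RowsBalanced p.1 p.2.2.2 ∧ RowsBalanced p.2.1 p.2.2.2 ∧ RowsBalanced p.2.2.1 p.2.2.2}
  have image_eq : {H : Matrix (Fin 4) (Fin 4) ℝ |
      (∀ i j, H i j = 1 ∨ H i j = -1) ∧ H * Hᵀ = (4 : ℝ) • 1} = signMatrix '' S := by
    ext H
    constructor
    · rintro ⟨hH, hmul⟩
      obtain ⟨⟨a, b, c, d⟩, rfl⟩ := exists_signMatrix_eq hH
      exact ⟨_, by simpa [S] using (signMatrix_mul_transpose_iff a b c d).1 hmul, rfl⟩
    · rintro ⟨⟨a, b, c, d⟩, hp, rfl⟩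
      refine ⟨fun i j => ?_, (signMatrix_mul_transpose_iff a b c d).2 (by simpa [S] using hp)⟩
      simp only [signMatrix, Matrix.of_apply, boolSign]
      split <;> simp
  rw [image_eq, Set.ncard_image_of_injective _ signMatrix_injective, Set.ncard_coe_finset,
    ← sum_balanced_quadruples]
  simp only [S, Finset.card_filter, Fintype.sum_prod_type, ite_and,
    Finset.sum_ite_irrel, Finset.sum_const_zero]
end

section
/- Let (j₀,k₀), (j₁,k₁), (j₂,k₂), (j₃,k₃) be four ordered pairs of distinct indices in {1,2,3,4}, and let M = B(j₃,k₃)·B(j₂,k₂)·B(j₁,k₁)·B(j₀,k₀) be the corresponding four-beam-splitter network matrix (the beam splitter indexed 0 acting first). Then every entry of M has absolute value 1/2 (i.e., M is a balanced four-splitter matrix) if and only if all three of the following hold: (1) each index m ∈ {1,2,3,4} belongs to exactly two of the four unordered pairs {jᵢ,kᵢ}; (2) the unordered pairs {j₀,k₀} and {j₁,k₁} of the first two beam splitters are disjoint (so together they cover all four indices); (3) no two of the four unordered pairs {jᵢ,kᵢ} are equal. -/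
open Matrix

/-- The 4×4 real balanced beam-splitter matrix `B(j,k)`: it agrees with the
identity except in rows and columns `j` and `k`, where
`B jj = B kk = 1/√2`, `B jk = −1/√2`, `B kj = 1/√2`. -/
noncomputable def Bsplit (j k : Fin 4) : Matrix (Fin 4) (Fin 4) ℝ :=
  fun a b =>
    if a = j then (if b = j then 1 / Real.sqrt 2 else if b = k then -(1 / Real.sqrt 2) else 0)
    else if a = k then (if b = j then 1 / Real.sqrt 2 else if b = k then 1 / Real.sqrt 2 else 0)
    else if b = a then 1 else 0

/-- The projection onto the modes left alone by a beam splitter on `j, k`. -/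
def idlePart (j k : Fin 4) : Matrix (Fin 4) (Fin 4) ℤ :=
  fun a b => if a = j then 0 else if a = k then 0 else if b = a then 1 else 0

/-- The action of a beam splitter on the modes `j, k`, scaled by `√2`. -/
def mixingPart (j k : Fin 4) : Matrix (Fin 4) (Fin 4) ℤ :=
  fun a b =>
    if a = j then (if b = j then 1 else if b = k then -1 else 0)
    else if a = k then (if b = j then 1 else if b = k then 1 else 0)
    else 0

/-- The product of two beam splitters on disjoint pairs, scaled by `√2`. -/
def disjointLayer (j k j' k' : Fin 4) : Matrix (Fin 4) (Fin 4) ℤ :=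
  mixingPart j k + mixingPart j' k'

theorem Bsplit_eq_idlePart_add_mixingPart (j k : Fin 4) :
    Bsplit j k = (idlePart j k).map (Int.cast : ℤ → ℝ) +
      (1 / Real.sqrt 2) • (mixingPart j k).map (Int.cast : ℤ → ℝ) := by
  ext a b
  simp only [Bsplit, idlePart, mixingPart, Matrix.add_apply, Matrix.smul_apply, Matrix.map_apply,
    smul_eq_mul]
  split_ifs <;> simp

theorem idlePart_mixingPart_mul_of_cover :
    ∀ j k : Fin 4, j ≠ k → ∀ j' k' : Fin 4, j' ≠ k' →
      (∀ m, m = j ∨ m = k ∨ m = j' ∨ m = k') →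
      idlePart j k * idlePart j' k' = 0 ∧ mixingPart j k * mixingPart j' k' = 0 ∧
        idlePart j k * mixingPart j' k' + mixingPart j k * idlePart j' k' =
          disjointLayer j k j' k' := by
  decide +kernel

theorem Bsplit_mul_Bsplit_of_cover {j k j' k' : Fin 4} (h : j ≠ k) (h' : j' ≠ k')
    (hc : ∀ m, m = j ∨ m = k ∨ m = j' ∨ m = k') :
    Bsplit j k * Bsplit j' k' =
      (1 / Real.sqrt 2) • (disjointLayer j k j' k').map (Int.cast : ℤ → ℝ) := by
  obtain ⟨e1, e2, e3⟩ := idlePart_mixingPart_mul_of_cover j k h j' k' h' hc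
  have cast_mul (A B : Matrix (Fin 4) (Fin 4) ℤ) :
      A.map (Int.cast : ℤ → ℝ) * B.map Int.cast = (A * B).map Int.cast :=
    (Matrix.map_mul (f := Int.castRingHom ℝ)).symm
  rw [← e3, Bsplit_eq_idlePart_add_mixingPart, Bsplit_eq_idlePart_add_mixingPart,
    Matrix.map_add _ Int.cast_add]
  simp only [add_mul, mul_add, Matrix.smul_mul, Matrix.mul_smul, cast_mul, e1, e2, smul_add]
  simp [add_comm]

/-- A beam splitter on `j, k` can transfer amplitude from mode `b` to mode `a`. -/
def Couples (j k a b : Fin 4) : Prop :=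
  a = b ∨ ((a = j ∨ a = k) ∧ (b = j ∨ b = k))

instance (j k a b : Fin 4) : Decidable (Couples j k a b) :=
  inferInstanceAs (Decidable (_ ∨ _))

theorem Bsplit_apply_eq_zero {j k a b : Fin 4} (h : ¬ Couples j k a b) : Bsplit j k a b = 0 := by
  simp only [Couples] at h
  simp only [Bsplit]
  split_ifs <;> grind

theorem exists_not_couples :
    ∀ j k j' k' m : Fin 4,
      (∃ b, ∀ c, Couples j k m c → ¬ Couples j' k' c b) ∧
      (∃ a, ∀ c, Couples j k a c → ¬ Couples j' k' c m) := by
  decide +kernel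

theorem Bsplit_mul_apply_eq_zero {j k j' k' a b : Fin 4}
    (h : ∀ c, Couples j k a c → ¬ Couples j' k' c b) : (Bsplit j k * Bsplit j' k') a b = 0 := by
  rw [Matrix.mul_apply]
  refine Finset.sum_eq_zero fun c _ => ?_
  by_cases hc : Couples j k a c
  · rw [Bsplit_apply_eq_zero (h c hc), mul_zero]
  · rw [Bsplit_apply_eq_zero hc, zero_mul]

theorem Bsplit_mul_apply_of_ne {j k a : Fin 4} (hj : a ≠ j) (hk : a ≠ k)
    (A : Matrix (Fin 4) (Fin 4) ℝ) (b : Fin 4) : (Bsplit j k * A) a b = A a b := by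
  simp [Matrix.mul_apply, Bsplit, hj, hk]

theorem mul_Bsplit_apply_of_ne {j k b : Fin 4} (hj : b ≠ j) (hk : b ≠ k)
    (A : Matrix (Fin 4) (Fin 4) ℝ) (a : Fin 4) : (A * Bsplit j k) a b = A a b := by
  have h (c : Fin 4) : Bsplit j k c b = if c = b then 1 else 0 := by
    simp only [Bsplit]
    split_ifs <;> grind
  simp [Matrix.mul_apply, h]

/-- If no entry of the product vanishes, the last two pairs cover all modes, and so do the
first two. -/
theorem cover_of_forall_ne_zero {j k : Fin 4 → Fin 4}
    (h : ∀ a b, (Bsplit (j 3) (k 3) * Bsplit (j 2) (k 2) *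
      (Bsplit (j 1) (k 1) * Bsplit (j 0) (k 0))) a b ≠ 0) :
    (∀ m, m = j 3 ∨ m = k 3 ∨ m = j 2 ∨ m = k 2) ∧
      (∀ m, m = j 1 ∨ m = k 1 ∨ m = j 0 ∨ m = k 0) := by
  constructor
  · intro m
    by_contra! hm
    obtain ⟨b, hb⟩ := (exists_not_couples (j 1) (k 1) (j 0) (k 0) m).1
    apply h m b
    rw [Matrix.mul_assoc, Bsplit_mul_apply_of_ne hm.1 hm.2.1,
      Bsplit_mul_apply_of_ne hm.2.2.1 hm.2.2.2, Bsplit_mul_apply_eq_zero hb]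
  · intro m
    by_contra! hm
    obtain ⟨a, ha⟩ := (exists_not_couples (j 3) (k 3) (j 2) (k 2) m).2
    apply h a m
    rw [← Matrix.mul_assoc, mul_Bsplit_apply_of_ne hm.2.2.1 hm.2.2.2,
      mul_Bsplit_apply_of_ne hm.1 hm.2.1, Bsplit_mul_apply_eq_zero ha]

set_option synthInstance.maxSize 1000 in
/-- Two disjoint layers compose to a matrix of signs exactly when the pairs of the first layer
differ from those of the second. -/
theorem abs_disjointLayer_mul_eq_one_iff :
    ∀ j₃ k₃ : Fin 4, j₃ ≠ k₃ → ∀ j₂ k₂ : Fin 4, j₂ ≠ k₂ →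
      (∀ m, m = j₃ ∨ m = k₃ ∨ m = j₂ ∨ m = k₂) →
    ∀ j₁ k₁ : Fin 4, j₁ ≠ k₁ → ∀ j₀ k₀ : Fin 4, j₀ ≠ k₀ →
      (∀ m, m = j₁ ∨ m = k₁ ∨ m = j₀ ∨ m = k₀) →
    ((∀ a b, |(disjointLayer j₃ k₃ j₂ k₂ * disjointLayer j₁ k₁ j₀ k₀) a b| = 1) ↔
      ¬ Couples j₃ k₃ j₁ k₁ ∧ ¬ Couples j₃ k₃ j₀ k₀) := by
  decide +kernel

theorem abs_network_apply_eq_half_iff {j k : Fin 4 → Fin 4} (hjk : ∀ i, j i ≠ k i)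
    (h₁ : ∀ m, m = j 3 ∨ m = k 3 ∨ m = j 2 ∨ m = k 2)
    (h₀ : ∀ m, m = j 1 ∨ m = k 1 ∨ m = j 0 ∨ m = k 0) :
    (∀ a b, |(Bsplit (j 3) (k 3) * Bsplit (j 2) (k 2) *
      (Bsplit (j 1) (k 1) * Bsplit (j 0) (k 0))) a b| = 1 / 2) ↔
      ¬ Couples (j 3) (k 3) (j 1) (k 1) ∧ ¬ Couples (j 3) (k 3) (j 0) (k 0) := by
  rw [← abs_disjointLayer_mul_eq_one_iff _ _ (hjk 3) _ _ (hjk 2) h₁ _ _ (hjk 1) _ _ (hjk 0) h₀,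
    Bsplit_mul_Bsplit_of_cover (hjk 3) (hjk 2) h₁, Bsplit_mul_Bsplit_of_cover (hjk 1) (hjk 0) h₀]
  refine forall₂_congr fun a b => ?_
  have hs : 1 / Real.sqrt 2 * (1 / Real.sqrt 2) = 1 / 2 := by
    rw [div_mul_div_comm, Real.mul_self_sqrt (by norm_num), one_mul]
  have hm : (disjointLayer (j 3) (k 3) (j 2) (k 2)).map (Int.cast : ℤ → ℝ) *
      (disjointLayer (j 1) (k 1) (j 0) (k 0)).map Int.cast =
      (disjointLayer (j 3) (k 3) (j 2) (k 2) * disjointLayer (j 1) (k 1) (j 0) (k 0)).map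
        Int.cast :=
    (Matrix.map_mul (f := Int.castRingHom ℝ)).symm
  rw [Matrix.smul_mul, Matrix.mul_smul, smul_smul, hs, hm, Matrix.smul_apply, Matrix.map_apply,
    smul_eq_mul, abs_mul, ← Int.cast_abs, abs_of_pos (by norm_num : (0 : ℝ) < 1 / 2),
    mul_eq_left₀ (by norm_num), Int.cast_eq_one]

theorem cover_iff_inter_eq_empty :
    ∀ j k : Fin 4, j ≠ k → ∀ j' k' : Fin 4, j' ≠ k' →
      ((∀ m, m = j ∨ m = k ∨ m = j' ∨ m = k') ↔
        ({j', k'} : Finset (Fin 4)) ∩ {j, k} = ∅) := by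
  decide +kernel

theorem cover_iff_count_eq_one :
    ∀ j k : Fin 4, j ≠ k → ∀ j' k' : Fin 4, j' ≠ k' →
      ((∀ m, m = j ∨ m = k ∨ m = j' ∨ m = k') ↔
        ∀ m, (if m = j ∨ m = k then 1 else 0) + (if m = j' ∨ m = k' then 1 else 0) = 1) := by
  decide +kernel

theorem pair_eq_iff_couples :
    ∀ j k : Fin 4, j ≠ k → ∀ j' k' : Fin 4, j' ≠ k' →
      (({j, k} : Finset (Fin 4)) = {j', k'} ↔ Couples j k j' k') := by
  decide +kernel

set_option synthInstance.maxSize 1000 in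
theorem not_couples_of_cover :
    ∀ j₃ k₃ : Fin 4, j₃ ≠ k₃ → ∀ j₂ k₂ : Fin 4, j₂ ≠ k₂ →
      (∀ m, m = j₃ ∨ m = k₃ ∨ m = j₂ ∨ m = k₂) →
    ∀ j₁ k₁ : Fin 4, j₁ ≠ k₁ → ∀ j₀ k₀ : Fin 4, j₀ ≠ k₀ →
      (∀ m, m = j₁ ∨ m = k₁ ∨ m = j₀ ∨ m = k₀) →
    ¬ Couples j₃ k₃ j₁ k₁ ∧ ¬ Couples j₃ k₃ j₀ k₀ →
      ¬ Couples j₃ k₃ j₂ k₂ ∧ ¬ Couples j₂ k₂ j₁ k₁ ∧ ¬ Couples j₂ k₂ j₀ k₀ ∧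
        ¬ Couples j₁ k₁ j₀ k₀ := by
  decide +kernel

/-- If the first two pairs cover all modes, each mode lies in exactly two of the four pairs
exactly when the last two pairs cover all modes. -/
theorem card_incident_eq_two_iff {j k : Fin 4 → Fin 4} (hjk : ∀ i, j i ≠ k i)
    (h₀ : ∀ m, m = j 1 ∨ m = k 1 ∨ m = j 0 ∨ m = k 0) :
    (∀ m : Fin 4, (Finset.univ.filter (fun i : Fin 4 => m = j i ∨ m = k i)).card = 2) ↔
      ∀ m, m = j 3 ∨ m = k 3 ∨ m = j 2 ∨ m = k 2 := by
  rw [cover_iff_count_eq_one _ _ (hjk 3) _ _ (hjk 2)]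
  rw [cover_iff_count_eq_one _ _ (hjk 1) _ _ (hjk 0)] at h₀
  refine forall_congr' fun m => ?_
  have := h₀ m
  rw [Finset.card_filter, Fin.sum_univ_four]
  omega

/-- If the first two pairs and the last two pairs cover all modes, the four pairs are distinct
as soon as the last one differs from the first two. -/
theorem pairs_distinct_iff {j k : Fin 4 → Fin 4} (hjk : ∀ i, j i ≠ k i)
    (h₁ : ∀ m, m = j 3 ∨ m = k 3 ∨ m = j 2 ∨ m = k 2)
    (h₀ : ∀ m, m = j 1 ∨ m = k 1 ∨ m = j 0 ∨ m = k 0) :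
    (∀ i i' : Fin 4, i ≠ i' →
        ({j i, k i} : Finset (Fin 4)) ≠ ({j i', k i'} : Finset (Fin 4))) ↔
      ¬ Couples (j 3) (k 3) (j 1) (k 1) ∧ ¬ Couples (j 3) (k 3) (j 0) (k 0) := by
  have he (i i' : Fin 4) := pair_eq_iff_couples _ _ (hjk i) _ _ (hjk i')
  constructor
  · intro h
    exact ⟨fun hc => h 3 1 (by decide) ((he 3 1).2 hc),
      fun hc => h 3 0 (by decide) ((he 3 0).2 hc)⟩
  · intro h
    obtain ⟨h32, h21, h20, h10⟩ := not_couples_of_cover _ _ (hjk 3) _ _ (hjk 2) h₁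
      _ _ (hjk 1) _ _ (hjk 0) h₀ h
    have key (i i' : Fin 4) (hlt : i' < i) : ({j i, k i} : Finset (Fin 4)) ≠ {j i', k i'} := by
      rw [Ne, he]
      fin_cases i <;> fin_cases i' <;>
        first
        | exact absurd hlt (by decide)
        | assumption
        | exact h.1
        | exact h.2
    intro i i' hne
    rcases lt_or_gt_of_ne hne with hlt | hlt
    · exact (key i' i hlt).symm
    · exact key i i' hlt

/-- A network of four balanced beam splitters (the one indexed `0` acting first)
is a balanced four-splitter if and only if: (1) each mode belongs to exactly two
of the four unordered pairs; (2) the unordered pairs of the first two beam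
splitters are disjoint; (3) no two of the four unordered pairs are equal. -/
theorem four_beam_splitter_network_balanced_iff
    (j k : Fin 4 → Fin 4) (hjk : ∀ i, j i ≠ k i) :
    (∀ a b, |(Bsplit (j 3) (k 3) * Bsplit (j 2) (k 2) *
        Bsplit (j 1) (k 1) * Bsplit (j 0) (k 0)) a b| = 1 / 2)
    ↔ ((∀ m : Fin 4,
          (Finset.univ.filter (fun i : Fin 4 => m = j i ∨ m = k i)).card = 2)
        ∧ (({j 0, k 0} : Finset (Fin 4)) ∩ ({j 1, k 1} : Finset (Fin 4)) = ∅)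
        ∧ (∀ i i' : Fin 4, i ≠ i' →
            ({j i, k i} : Finset (Fin 4)) ≠ ({j i', k i'} : Finset (Fin 4)))) := by
  rw [Matrix.mul_assoc (Bsplit (j 3) (k 3) * Bsplit (j 2) (k 2)),
    ← cover_iff_inter_eq_empty _ _ (hjk 1) _ _ (hjk 0)]
  constructor
  · intro h
    obtain ⟨h₁, h₀⟩ := cover_of_forall_ne_zero fun a b => abs_pos.1 (by rw [h a b]; norm_num)
    exact ⟨(card_incident_eq_two_iff hjk h₀).2 h₁, h₀,
      (pairs_distinct_iff hjk h₁ h₀).2 ((abs_network_apply_eq_half_iff hjk h₁ h₀).1 h)⟩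
  · rintro ⟨hcard, h₀, hne⟩
    have h₁ := (card_incident_eq_two_iff hjk h₀).1 hcard
    exact (abs_network_apply_eq_half_iff hjk h₁ h₀).2 ((pairs_distinct_iff hjk h₁ h₀).1 hne)
end

section
/- Let {j,k,ℓ,m} = {1,2,3,4} be an enumeration of the four indices, and choose S₁ ∈ {B(j,k), B(k,j)}, S₂ ∈ {B(ℓ,m), B(m,ℓ)}, S₃ ∈ {B(j,ℓ), B(ℓ,j)}, S₄ ∈ {B(k,m), B(m,k)}. Then the product S₄·S₃·S₂·S₁ is a 4×4 real orthogonal matrix all of whose entries have absolute value 1/2 (a balanced four-splitter matrix). -/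
open Matrix

/-- The product of four rotations in the coordinate planes `(0,1)`, `(2,3)`, `(0,2)`, `(1,3)`,
with common cosine `c` and sines `t₁`, `t₂`, `t₃`, `t₄`, has pairwise products as entries. -/
theorem four_rotations_mul (c t₁ t₂ t₃ t₄ : ℝ) :
    !![1, 0, 0, 0; 0, c, 0, -t₄; 0, 0, 1, 0; 0, t₄, 0, c] *
      !![c, 0, -t₃, 0; 0, 1, 0, 0; t₃, 0, c, 0; 0, 0, 0, 1] *
      !![1, 0, 0, 0; 0, 1, 0, 0; 0, 0, c, -t₂; 0, 0, t₂, c] *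
      !![c, -t₁, 0, 0; t₁, c, 0, 0; 0, 0, 1, 0; 0, 0, 0, 1] =
    !![c * c, -(c * t₁), -(t₃ * c), t₃ * t₂;
       c * t₁, c * c, -(t₄ * t₂), -(t₄ * c);
       t₃ * c, -(t₃ * t₁), c * c, -(c * t₂);
       t₄ * t₁, t₄ * c, c * t₂, c * c] := by
  ext a b
  fin_cases a <;> fin_cases b <;> simp [Matrix.mul_apply, Fin.sum_univ_four]

theorem four_rotations_balanced {c t₁ t₂ t₃ t₄ : ℝ} (hc : c ^ 2 = 1 / 2)
    (h₁ : t₁ ^ 2 = 1 / 2) (h₂ : t₂ ^ 2 = 1 / 2) (h₃ : t₃ ^ 2 = 1 / 2) (h₄ : t₄ ^ 2 = 1 / 2)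
    {M : Matrix (Fin 4) (Fin 4) ℝ}
    (hM : M = !![c * c, -(c * t₁), -(t₃ * c), t₃ * t₂;
       c * t₁, c * c, -(t₄ * t₂), -(t₄ * c);
       t₃ * c, -(t₃ * t₁), c * c, -(c * t₂);
       t₄ * t₁, t₄ * c, c * t₂, c * c]) :
    Mᵀ * M = 1 ∧ ∀ a b, |M a b| = 1 / 2 := by
  subst hM
  have abs_mul_eq {x y : ℝ} (hx : x ^ 2 = 1 / 2) (hy : y ^ 2 = 1 / 2) : |x * y| = 1 / 2 := by
    rw [← sq_eq_sq₀ (abs_nonneg _) (by norm_num), sq_abs, mul_pow, hx, hy]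
    norm_num
  constructor
  · ext a b
    fin_cases a <;> fin_cases b <;>
      simp [Matrix.mul_apply, Fin.sum_univ_four] <;> grind
  · intro a b
    fin_cases a <;> fin_cases b <;> simp only [Fin.zero_eta, Fin.mk_one, Fin.reduceFinMk,
      Matrix.of_apply, Matrix.cons_val, abs_neg] <;> apply abs_mul_eq <;> assumption

theorem Bsplit_submatrix {σ : Fin 4 → Fin 4} (hσ : Function.Injective σ) (j k : Fin 4) :
    (Bsplit (σ j) (σ k)).submatrix σ σ = Bsplit j k := by
  ext a b
  simp only [Bsplit, Matrix.submatrix_apply, hσ.eq_iff]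

theorem exists_rotation_of_Bsplit_zero_one {S : Matrix (Fin 4) (Fin 4) ℝ}
    (h : S = Bsplit 0 1 ∨ S = Bsplit 1 0) :
    ∃ t : ℝ, t ^ 2 = 1 / 2 ∧
      S = !![1 / √2, -t, 0, 0; t, 1 / √2, 0, 0; 0, 0, 1, 0; 0, 0, 0, 1] := by
  rcases h with rfl | rfl
  · refine ⟨1 / √2, by norm_num [div_pow], ?_⟩
    ext a b
    fin_cases a <;> fin_cases b <;> simp [Bsplit]
  · refine ⟨-(1 / √2), by norm_num [div_pow], ?_⟩
    ext a b
    fin_cases a <;> fin_cases b <;> simp [Bsplit]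

theorem exists_rotation_of_Bsplit_two_three {S : Matrix (Fin 4) (Fin 4) ℝ}
    (h : S = Bsplit 2 3 ∨ S = Bsplit 3 2) :
    ∃ t : ℝ, t ^ 2 = 1 / 2 ∧
      S = !![1, 0, 0, 0; 0, 1, 0, 0; 0, 0, 1 / √2, -t; 0, 0, t, 1 / √2] := by
  rcases h with rfl | rfl
  · refine ⟨1 / √2, by norm_num [div_pow], ?_⟩
    ext a b
    fin_cases a <;> fin_cases b <;> simp [Bsplit]
  · refine ⟨-(1 / √2), by norm_num [div_pow], ?_⟩
    ext a b
    fin_cases a <;> fin_cases b <;> simp [Bsplit]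

theorem exists_rotation_of_Bsplit_zero_two {S : Matrix (Fin 4) (Fin 4) ℝ}
    (h : S = Bsplit 0 2 ∨ S = Bsplit 2 0) :
    ∃ t : ℝ, t ^ 2 = 1 / 2 ∧
      S = !![1 / √2, 0, -t, 0; 0, 1, 0, 0; t, 0, 1 / √2, 0; 0, 0, 0, 1] := by
  rcases h with rfl | rfl
  · refine ⟨1 / √2, by norm_num [div_pow], ?_⟩
    ext a b
    fin_cases a <;> fin_cases b <;> simp [Bsplit]
  · refine ⟨-(1 / √2), by norm_num [div_pow], ?_⟩
    ext a b
    fin_cases a <;> fin_cases b <;> simp [Bsplit]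

theorem exists_rotation_of_Bsplit_one_three {S : Matrix (Fin 4) (Fin 4) ℝ}
    (h : S = Bsplit 1 3 ∨ S = Bsplit 3 1) :
    ∃ t : ℝ, t ^ 2 = 1 / 2 ∧
      S = !![1, 0, 0, 0; 0, 1 / √2, 0, -t; 0, 0, 1, 0; 0, t, 0, 1 / √2] := by
  rcases h with rfl | rfl
  · refine ⟨1 / √2, by norm_num [div_pow], ?_⟩
    ext a b
    fin_cases a <;> fin_cases b <;> simp [Bsplit]
  · refine ⟨-(1 / √2), by norm_num [div_pow], ?_⟩
    ext a b
    fin_cases a <;> fin_cases b <;> simp [Bsplit]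

/-- For any enumeration `{j,k,l,m}` of the four modes, a product
`S₄·S₃·S₂·S₁` with `S₁ ∈ {B(j,k), B(k,j)}`, `S₂ ∈ {B(l,m), B(m,l)}`,
`S₃ ∈ {B(j,l), B(l,j)}`, `S₄ ∈ {B(k,m), B(m,k)}` is a balanced four-splitter
matrix: real orthogonal with all entries of absolute value `1/2`. -/
theorem four_splitter_construction
    (j k l m : Fin 4)
    (henum : ({j, k, l, m} : Finset (Fin 4)) = Finset.univ)
    (S₁ S₂ S₃ S₄ : Matrix (Fin 4) (Fin 4) ℝ)
    (h₁ : S₁ = Bsplit j k ∨ S₁ = Bsplit k j)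
    (h₂ : S₂ = Bsplit l m ∨ S₂ = Bsplit m l)
    (h₃ : S₃ = Bsplit j l ∨ S₃ = Bsplit l j)
    (h₄ : S₄ = Bsplit k m ∨ S₄ = Bsplit m k) :
    (S₄ * S₃ * S₂ * S₁)ᵀ * (S₄ * S₃ * S₂ * S₁) = 1 ∧
      ∀ a b, |(S₄ * S₃ * S₂ * S₁) a b| = 1 / 2 := by
  have hsurj : Function.Surjective ![j, k, l, m] := by
    intro x
    have hx : x ∈ ({j, k, l, m} : Finset (Fin 4)) := henum ▸ Finset.mem_univ x
    simp only [Finset.mem_insert, Finset.mem_singleton] at hx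
    rcases hx with rfl | rfl | rfl | rfl
    exacts [⟨0, rfl⟩, ⟨1, rfl⟩, ⟨2, rfl⟩, ⟨3, rfl⟩]
  have hinj : Function.Injective ![j, k, l, m] := Finite.injective_iff_surjective.mpr hsurj
  let σ : Fin 4 ≃ Fin 4 := Equiv.ofBijective _ ⟨hinj, hsurj⟩
  have relabel {S : Matrix (Fin 4) (Fin 4) ℝ} (p q : Fin 4)
      (h : S = Bsplit (σ p) (σ q) ∨ S = Bsplit (σ q) (σ p)) :
      S.submatrix σ σ = Bsplit p q ∨ S.submatrix σ σ = Bsplit q p :=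
    h.imp (by rintro rfl; exact Bsplit_submatrix σ.injective p q)
      (by rintro rfl; exact Bsplit_submatrix σ.injective q p)
  obtain ⟨t₁, ht₁, e₁⟩ := exists_rotation_of_Bsplit_zero_one (relabel 0 1 h₁)
  obtain ⟨t₂, ht₂, e₂⟩ := exists_rotation_of_Bsplit_two_three (relabel 2 3 h₂)
  obtain ⟨t₃, ht₃, e₃⟩ := exists_rotation_of_Bsplit_zero_two (relabel 0 2 h₃)
  obtain ⟨t₄, ht₄, e₄⟩ := exists_rotation_of_Bsplit_one_three (relabel 1 3 h₄)
  have hprod := four_rotations_mul (1 / √2) t₁ t₂ t₃ t₄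
  rw [← e₁, ← e₂, ← e₃, ← e₄] at hprod
  simp only [Matrix.submatrix_mul_equiv] at hprod
  obtain ⟨horth, habs⟩ := four_rotations_balanced (by norm_num [div_pow]) ht₁ ht₂ ht₃ ht₄ hprod
  constructor
  · rw [Matrix.transpose_submatrix, Matrix.submatrix_mul_equiv] at horth
    rw [← Matrix.submatrix_one_equiv σ] at horth
    exact (Matrix.reindex σ.symm σ.symm).injective horth
  · intro a b
    simpa using habs (σ.symm a) (σ.symm b)
end

section
/- Let N ≥ 1, let R and R' be N×N real orthogonal matrices, and let θ, θ' : {1,…,N} → ℝ with θⱼ, θ'ⱼ ∈ (−π/2, π/2] for all j. Assume R is neither block diagonal nor a row permutation away from block diagonal, in the following precise sense: whenever S and T are subsets of {1,…,N} with |S| = |T| such that R_{jk} = 0 for all j ∈ T, k ∉ S and R_{jk} = 0 for all j ∉ T, k ∈ S, then S = ∅ or S = {1,…,N}. If, as complex matrices, diag(e^{iθ₁},…,e^{iθ_N}) · R = R' · diag(e^{iθ'₁},…,e^{iθ'_N}), then there is a constant c such that θⱼ = c and θ'ⱼ = c for every j. -/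
open Matrix

/-- An orthogonal matrix supported on `T × S` and `Tᶜ × Sᶜ` has square blocks. -/
theorem card_eq_card_of_orthogonal_of_block {n : Type*} [Fintype n] [DecidableEq n]
    {R : Matrix n n ℝ} (hR : Rᵀ * R = 1) {S T : Finset n}
    (hT : ∀ j ∈ T, ∀ k, k ∉ S → R j k = 0) (hS : ∀ j, j ∉ T → ∀ k ∈ S, R j k = 0) :
    S.card = T.card := by
  have hR' : R * Rᵀ = 1 := mul_eq_one_comm.mp hR
  have hrow (j : n) : ∑ k, R j k * R j k = 1 := by
    have h := congrFun (congrFun hR' j) j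
    simpa [Matrix.mul_apply] using h
  have hcol (k : n) : ∑ j, R j k * R j k = 1 := by
    have h := congrFun (congrFun hR k) k
    simpa [Matrix.mul_apply] using h
  have h : (S.card : ℝ) = T.card := calc
    (S.card : ℝ) = ∑ k ∈ S, ∑ j, R j k * R j k := by simp [hcol]
    _ = ∑ k ∈ S, ∑ j ∈ T, R j k * R j k := by
      refine Finset.sum_congr rfl fun k hk => (Finset.sum_subset T.subset_univ ?_).symm
      intro j _ hj
      simp [hS j hj k hk]
    _ = ∑ j ∈ T, ∑ k ∈ S, R j k * R j k := Finset.sum_comm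
    _ = ∑ j ∈ T, ∑ k, R j k * R j k := by
      refine Finset.sum_congr rfl fun j hj => Finset.sum_subset S.subset_univ ?_
      intro k _ hk
      simp [hT j hj k hk]
    _ = T.card := by simp [hrow]
  exact_mod_cast h

/-- Two angles in `(-π/2, π/2]` agree if their unit complex numbers are real multiples of
each other. -/
theorem angle_eq_of_exp_mul_eq {a b r s : ℝ}
    (ha : a ∈ Set.Ioc (-(Real.pi / 2)) (Real.pi / 2))
    (hb : b ∈ Set.Ioc (-(Real.pi / 2)) (Real.pi / 2)) (hr : r ≠ 0)
    (h : Complex.exp (a * Complex.I) * r = s * Complex.exp (b * Complex.I)) : a = b := by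
  have hre := congrArg Complex.re h
  have him := congrArg Complex.im h
  simp only [Complex.re_mul_ofReal, Complex.im_mul_ofReal, Complex.re_ofReal_mul,
    Complex.im_ofReal_mul, Complex.exp_ofReal_mul_I_re, Complex.exp_ofReal_mul_I_im] at hre him
  have hsin : Real.sin (a - b) = 0 := by
    refine (mul_eq_zero.mp ?_).resolve_right hr
    rw [Real.sin_sub]
    linear_combination Real.cos b * him - Real.sin b * hre
  have := (Real.sin_eq_zero_iff_of_lt_of_lt (by linarith [ha.1, hb.2])
    (by linarith [ha.2, hb.1])).mp hsin
  linarith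

/-- Theorem 3 of the paper: if `R` is a real orthogonal matrix that is neither
block diagonal nor a row permutation away from block diagonal, and
`diag(e^{iθ}) · R = R' · diag(e^{iθ'})` as complex matrices for a real
orthogonal `R'` and angles in `(−π/2, π/2]`, then all the angles `θⱼ` and `θ'ⱼ`
are equal to a single constant. -/
theorem no_nontrivial_angle_cancellation
    (N : ℕ) (hN : 1 ≤ N)
    (R R' : Matrix (Fin N) (Fin N) ℝ)
    (hR : Rᵀ * R = 1) (hR' : R'ᵀ * R' = 1)
    (θ θ' : Fin N → ℝ)
    (hθ : ∀ j, θ j ∈ Set.Ioc (-(Real.pi / 2)) (Real.pi / 2))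
    (hθ' : ∀ j, θ' j ∈ Set.Ioc (-(Real.pi / 2)) (Real.pi / 2))
    (hblock : ∀ S T : Finset (Fin N), S.card = T.card →
      (∀ j ∈ T, ∀ k, k ∉ S → R j k = 0) →
      (∀ j, j ∉ T → ∀ k ∈ S, R j k = 0) →
      S = ∅ ∨ S = Finset.univ)
    (heq : Matrix.diagonal (fun j => Complex.exp ((θ j : ℂ) * Complex.I)) *
        R.map (fun x : ℝ => (x : ℂ)) =
      R'.map (fun x : ℝ => (x : ℂ)) *
        Matrix.diagonal (fun j => Complex.exp ((θ' j : ℂ) * Complex.I))) :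
    ∃ c : ℝ, (∀ j, θ j = c) ∧ (∀ j, θ' j = c) := by
  have hangle (j k : Fin N) (hjk : R j k ≠ 0) : θ j = θ' k := by
    refine angle_eq_of_exp_mul_eq (s := R' j k) (hθ j) (hθ' k) hjk ?_
    have h := congrFun (congrFun heq j) k
    simpa only [Matrix.diagonal_mul, Matrix.mul_diagonal, Matrix.map_apply] using h
  let c := θ' ⟨0, hN⟩
  let S : Finset (Fin N) := {k | θ' k = c}
  let T : Finset (Fin N) := {j | θ j = c}
  have hT : ∀ j ∈ T, ∀ k, k ∉ S → R j k = 0 := by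
    intro j hj k hk
    by_contra hjk
    simp only [S, T, Finset.mem_filter_univ] at hj hk
    exact hk ((hangle j k hjk).symm.trans hj)
  have hS : ∀ j, j ∉ T → ∀ k ∈ S, R j k = 0 := by
    intro j hj k hk
    by_contra hjk
    simp only [S, T, Finset.mem_filter_univ] at hj hk
    exact hj ((hangle j k hjk).trans hk)
  have hcard := card_eq_card_of_orthogonal_of_block hR hT hS
  have hSne : S ≠ ∅ := Finset.ne_empty_of_mem (a := ⟨0, hN⟩) (by simp [S, c])
  have hSuniv := (hblock S T hcard hT hS).resolve_left hSne
  have hTuniv : T = Finset.univ := by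
    rw [← Finset.card_eq_iff_eq_univ, ← hcard, hSuniv, Finset.card_univ]
  refine ⟨c, fun j => ?_, fun k => ?_⟩
  · simpa [T] using Finset.eq_univ_iff_forall.mp hTuniv j
  · simpa [S] using Finset.eq_univ_iff_forall.mp hSuniv k
end

section
/- Two balanced beam splitters on three modes can be re-expressed as a Tait–Bryan sequence of three beam splitters: with θ = arctan(1/√2) and θ' = −arctan(1/√3), one has the 3×3 matrix identity G₂₃(π/4) · G₁₂(π/4) = G₁₂(θ) · G₃₁(θ') · G₂₃(θ). -/
open Matrix

/-- The principal-axis rotation on coordinates (1,2) of three modes. -/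
noncomputable def G12 (φ : ℝ) : Matrix (Fin 3) (Fin 3) ℝ :=
  !![Real.cos φ, -Real.sin φ, 0;
     Real.sin φ, Real.cos φ, 0;
     0, 0, 1]

/-- The principal-axis rotation on coordinates (2,3) of three modes. -/
noncomputable def G23 (φ : ℝ) : Matrix (Fin 3) (Fin 3) ℝ :=
  !![1, 0, 0;
     0, Real.cos φ, -Real.sin φ;
     0, Real.sin φ, Real.cos φ]

/-- The principal-axis rotation on coordinates (3,1) of three modes:
`G₃₁(φ)₃₃ = cos φ`, `G₃₁(φ)₃₁ = −sin φ`, `G₃₁(φ)₁₃ = sin φ`,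
`G₃₁(φ)₁₁ = cos φ`, `G₃₁(φ)₂₂ = 1`. -/
noncomputable def G31 (φ : ℝ) : Matrix (Fin 3) (Fin 3) ℝ :=
  !![Real.cos φ, 0, Real.sin φ;
     0, 1, 0;
     -Real.sin φ, 0, Real.cos φ]

theorem cos_arctan_one_div_sqrt_two :
    Real.cos (Real.arctan (1 / √2)) = √2 * √3 / 3 := by
  have h : √(1 + (1 / √2) ^ 2) = √3 / √2 := by
    rw [← Real.sqrt_div (by norm_num), div_pow, Real.sq_sqrt (by norm_num)]
    norm_num
  rw [Real.cos_arctan, h]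
  field_simp
  norm_num

theorem sin_arctan_one_div_sqrt_two :
    Real.sin (Real.arctan (1 / √2)) = √3 / 3 := by
  rw [← Real.tan_mul_cos (Real.cos_arctan_pos _).ne', Real.tan_arctan,
    cos_arctan_one_div_sqrt_two]
  field_simp

theorem arctan_one_div_sqrt_three : Real.arctan (1 / √3) = Real.pi / 6 := by
  rw [← Real.tan_pi_div_six]
  exact Real.arctan_tan (by linarith [Real.pi_pos]) (by linarith [Real.pi_pos])

/-- Two balanced beam splitters on three modes re-expressed as a Tait–Bryan
sequence of three beam splitters: with `θ = arctan(1/√2)` and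
`θ' = −arctan(1/√3)`, one has `G₂₃(π/4)·G₁₂(π/4) = G₁₂(θ)·G₃₁(θ')·G₂₃(θ)`. -/
theorem tait_bryan_two_beam_splitters :
    G23 (Real.pi / 4) * G12 (Real.pi / 4) =
      G12 (Real.arctan (1 / Real.sqrt 2)) *
        G31 (-Real.arctan (1 / Real.sqrt 3)) *
        G23 (Real.arctan (1 / Real.sqrt 2)) := by
  have h2 : √2 ^ 2 = (2 : ℝ) := Real.sq_sqrt (by norm_num)
  have h3 : √3 ^ 2 = (3 : ℝ) := Real.sq_sqrt (by norm_num)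
  rw [arctan_one_div_sqrt_three]
  simp only [G12, G23, G31, Real.cos_neg, Real.sin_neg, Real.cos_pi_div_four,
    Real.sin_pi_div_four, Real.cos_pi_div_six, Real.sin_pi_div_six,
    cos_arctan_one_div_sqrt_two, sin_arctan_one_div_sqrt_two]
  ext i j
  fin_cases i <;> fin_cases j <;> simp [Matrix.mul_apply, Fin.sum_univ_three] <;> grind
end
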